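/- Correctness of the coNP-hardness reduction for LTL(F) model checking: let φ = ⋀_{i=1}^m (ℓ_{i,1} ∨ ℓ_{i,2} ∨ ℓ_{i,3}) be a propositional 3CNF formula over variables x₁,…,x_n (each ℓ_{i,t} a literal x_j or ¬x_j), and define the LTL(F) formula ψ := ⋁_{i=1}^m (χ(ℓ_{i,1}) ∧ χ(ℓ_{i,2}) ∧ χ(ℓ_{i,3})), where χ(x_j) := ¬F x_j and χ(¬x_j) := F x_j. Then every path π of the assignment structure S_n with π 0 = w₀ satisfies (S_n, π) ⊨ ψ if and only if φ is unsatisfiable as a propositional formula. -/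

import Mathlib

inductive LTL (P : Type) : Type
  | atom : P → LTL P
  | neg  : LTL P → LTL P
  | conj : LTL P → LTL P → LTL P
  | disj : LTL P → LTL P → LTL P
  | next : LTL P → LTL P
  | fut  : LTL P → LTL P
  | glob : LTL P → LTL P
  | untl : LTL P → LTL P → LTL P

structure Kripke (P W : Type) where
  R : W → W → Prop
  V : W → Set P

/-- Totality of the transition relation: every world has a successor. -/
def Kripke.Total {P W : Type} (A : Kripke P W) : Prop := ∀ w, ∃ w', A.R w w'

/-- A path in a Kripke structure. -/
def IsPath {P W : Type} (A : Kripke P W) (π : ℕ → W) : Prop := ∀ i, A.R (π i) (π (i + 1))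

/-- LTL satisfaction over a Kripke structure and a path. -/
def Sat {P W : Type} (A : Kripke P W) : LTL P → (ℕ → W) → Prop
  | .atom p, π => p ∈ A.V (π 0)
  | .neg φ, π => ¬ Sat A φ π
  | .conj φ ψ, π => Sat A φ π ∧ Sat A ψ π
  | .disj φ ψ, π => Sat A φ π ∨ Sat A ψ π
  | .next φ, π => Sat A φ (fun i => π (i + 1))
  | .fut φ, π => ∃ k, Sat A φ (fun i => π (k + i))
  | .glob φ, π => ∀ k, Sat A φ (fun i => π (k + i))
  | .untl φ ψ, π => ∃ k, Sat A ψ (fun i => π (k + i)) ∧ ∀ j < k, Sat A φ (fun i => π (j + i))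

/-- Worlds of the assignment structure `S_n`: `none` is `w₀`, `some (i, b)` is the world `(i, b)`
(only `1 ≤ i ≤ n` is actually reachable). Propositions are natural numbers; `x_i` is `i`. -/
abbrev SnW : Type := Option (ℕ × Bool)

/-- Transition relation of `S_n`. -/
def SnR (n : ℕ) : SnW → SnW → Prop
  | none, some (i, _) => i = 1
  | some (i, b), some (j, b') => (1 ≤ i ∧ i < n ∧ j = i + 1) ∨ (i = n ∧ j = n ∧ b' = b)
  | _, _ => False

/-- Valuation of `S_n`: world `(i, true)` is labeled with `x_i`. -/
def SnV (n : ℕ) : SnW → Set ℕ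
  | some (i, true) => if 1 ≤ i ∧ i ≤ n then {i} else ∅
  | _ => ∅

/-- The assignment structure `S_n`. -/
def Sn (n : ℕ) : Kripke ℕ SnW := ⟨SnR n, SnV n⟩

/-- `bigOr f m` is the disjunction `f 0 ∨ f 1 ∨ … ∨ f m`. -/
def bigOr {P : Type} (f : ℕ → LTL P) : ℕ → LTL P
  | 0 => f 0
  | m + 1 => .disj (bigOr f m) (f (m + 1))

/-- `χ` of a literal (variable index, polarity): `χ(x_j) = ¬F x_j`, `χ(¬x_j) = F x_j`. -/
def chiF (l : ℕ × Bool) : LTL ℕ :=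
  if l.2 then .neg (.fut (.atom l.1)) else .fut (.atom l.1)

/-- The LTL(F) formula `ψ = ⋁_{i=1}^m (χ(ℓ_{i,1}) ∧ χ(ℓ_{i,2}) ∧ χ(ℓ_{i,3}))`
(clauses indexed `0,…,m-1`). -/
def psiF (lit : ℕ → ℕ → ℕ × Bool) (m : ℕ) : LTL ℕ :=
  bigOr (fun i => .conj (chiF (lit i 0)) (.conj (chiF (lit i 1)) (chiF (lit i 2)))) (m - 1)

/-- A literal `(j, pol)` is true under assignment `α` iff `α j = pol`. -/
def litTrue (α : ℕ → Bool) (l : ℕ × Bool) : Prop := α l.1 = l.2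

theorem sat_bigOr {P W : Type} (A : Kripke P W) (f : ℕ → LTL P) (π : ℕ → W) (m : ℕ) :
    Sat A (bigOr f m) π ↔ ∃ i ≤ m, Sat A (f i) π := by
  induction m with
  | zero => simp [bigOr]
  | succ m ih =>
    simp only [bigOr, Sat, ih]
    constructor
    · rintro (⟨i, hi, h⟩ | h)
      · exact ⟨i, by omega, h⟩
      · exact ⟨m + 1, le_rfl, h⟩
    · rintro ⟨i, hi, h⟩
      rcases Nat.lt_or_ge m i with h1 | h1
      · have : i = m + 1 := by omega
        subst this
        exact Or.inr h
      · exact Or.inl ⟨i, h1, h⟩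

theorem sat_chiF (n : ℕ) (π : ℕ → SnW) (α : ℕ → Bool) (l : ℕ × Bool)
    (h : (∃ k, l.1 ∈ SnV n (π k)) ↔ α l.1 = true) :
    Sat (Sn n) (chiF l) π ↔ ¬ litTrue α l := by
  obtain ⟨j, b⟩ := l
  have h' : Sat (Sn n) (.fut (.atom j)) π ↔ α j = true := by
    simpa [Sat, Sn] using h
  cases b
  · simp [chiF, litTrue, h']
  · simp only [chiF, litTrue, if_true]
    simp only [Sat] at h' ⊢
    rw [h']

theorem sat_psiF (n m : ℕ) (hm : 1 ≤ m) (lit : ℕ → ℕ → ℕ × Bool)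
    (π : ℕ → SnW) (α : ℕ → Bool)
    (h : ∀ i < m, ∀ t < 3, (∃ k, (lit i t).1 ∈ SnV n (π k)) ↔ α (lit i t).1 = true) :
    Sat (Sn n) (psiF lit m) π ↔ ¬ ∀ i < m,
      litTrue α (lit i 0) ∨ litTrue α (lit i 1) ∨ litTrue α (lit i 2) := by
  rw [psiF, sat_bigOr]
  push Not
  refine exists_congr fun i => ?_
  have e : i ≤ m - 1 ↔ i < m := by omega
  rw [e]
  refine and_congr_right fun hi => ?_
  simp only [Sat]
  rw [sat_chiF n π α _ (h i hi 0 (by omega)), sat_chiF n π α _ (h i hi 1 (by omega)),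
    sat_chiF n π α _ (h i hi 2 (by omega))]

/-- The path of an assignment. -/
def asgPath (n : ℕ) (α : ℕ → Bool) : ℕ → SnW
  | 0 => none
  | k + 1 => some (min (k + 1) n, α (min (k + 1) n))

theorem asgPath_isPath (n : ℕ) (hn : 1 ≤ n) (α : ℕ → Bool) : IsPath (Sn n) (asgPath n α) := by
  intro k
  cases k with
  | zero => simp [Sn, SnR, asgPath, hn]
  | succ k =>
    simp only [Sn, SnR, asgPath]
    rcases Nat.lt_or_ge (k + 1) n with h | h
    · left; omega
    · right
      have e1 : min (k + 1) n = n := by omega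
      have e2 : min (k + 1 + 1) n = n := by omega
      simp [e1, e2]

theorem mem_SnV (n j i : ℕ) (b : Bool) :
    j ∈ SnV n (some (i, b)) ↔ b = true ∧ (1 ≤ i ∧ i ≤ n) ∧ j = i := by
  cases b
  · simp [SnV]
  · simp only [SnV]
    split_ifs with h <;> simp [h]

theorem asgPath_val (n : ℕ) (α : ℕ → Bool) (j : ℕ) (h1 : 1 ≤ j) (h2 : j ≤ n) :
    (∃ k, j ∈ SnV n (asgPath n α k)) ↔ α j = true := by
  constructor
  · rintro ⟨k, hk⟩
    cases k with
    | zero => simp [asgPath, SnV] at hk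
    | succ k =>
      rw [asgPath, mem_SnV] at hk
      rw [hk.2.2]; exact hk.1
  · intro h
    obtain ⟨k, rfl⟩ : ∃ k, j = k + 1 := ⟨j - 1, by omega⟩
    refine ⟨k + 1, ?_⟩
    rw [asgPath, mem_SnV, min_eq_left h2]
    exact ⟨h, ⟨h1, h2⟩, rfl⟩

/-- every path of `S_n` from `w₀` satisfies `ψ` iff the 3CNF `φ` is unsatisfiable. -/
theorem ltl_fut_mc_conp_reduction (n m : ℕ) (hn : 1 ≤ n) (hm : 1 ≤ m)
    (lit : ℕ → ℕ → ℕ × Bool)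
    (hlit : ∀ i < m, ∀ t < 3, 1 ≤ (lit i t).1 ∧ (lit i t).1 ≤ n) :
    (∀ π : ℕ → SnW, IsPath (Sn n) π → π 0 = none → Sat (Sn n) (psiF lit m) π) ↔
    ¬ ∃ α : ℕ → Bool, ∀ i < m,
        litTrue α (lit i 0) ∨ litTrue α (lit i 1) ∨ litTrue α (lit i 2) := by
  classical
  constructor
  · rintro H ⟨α, hα⟩
    exact (sat_psiF n m hm lit (asgPath n α) α (fun i hi t ht =>
      asgPath_val n α _ (hlit i hi t ht).1 (hlit i hi t ht).2)).1
      (H _ (asgPath_isPath n hn α) rfl) hα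
  · intro H π _ _
    refine (sat_psiF n m hm lit π (fun j => decide (∃ k, j ∈ SnV n (π k)))
      (fun i hi t ht => by simp)).2 (fun h => H ⟨_, h⟩)
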